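/- Local asymptotic normality implies weak convergence to the Gaussian shift experiment. Let d ≥ 1 and, for each n, let {P_{n,t} : t ∈ ℝ^d} be probability measures on (Ω_n, F_n) such that for each t ∈ ℝ^d, P_{n,t} is absolutely continuous with respect to P_{n,0} with dP_{n,t}/dP_{n,0} = (1 + ε_n(t)) exp( t'Z_n − |t|²/2 ), where Z_n : Ω_n → ℝ^d does not depend on t, Z_n converges in distribution under P_{n,0} to the standard normal N(0, I_d), and ε_n(t) → 0 in P_{n,0}-probability for each fixed t. Let Q_t denote the N(t, I_d) distribution on ℝ^d. Then for every finite subset S of ℝ^d there exist probability kernels K_n from ℝ^d (with its Borel sigma-field) to (Ω_n, F_n) such that max_{t ∈ S} ‖Q_t K_n − P_{n,t}‖₁ → 0 as n → ∞. -/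

import Mathlib

open MeasureTheory ProbabilityTheory Filter Topology
open scoped ENNReal NNReal

/-- Total variation distance between two measures:
`‖μ − ν‖₁ = sup { |∫ f dμ − ∫ f dν| : f measurable, |f| ≤ 1 }`. -/
noncomputable def tvDist {α : Type*} [MeasurableSpace α] (μ ν : Measure α) : ℝ :=
  ⨆ f : { f : α → ℝ // Measurable f ∧ ∀ x, |f x| ≤ 1 },
    |∫ x, f.1 x ∂μ - ∫ x, f.1 x ∂ν|

/-- If two probability densities `u`, `p` have the same mass, the total variation distance is
controlled by the positive part of `u - p`. -/
theorem tvDist_withDensity_le {Ω : Type*} [MeasurableSpace Ω] {μ : Measure Ω} {u p : Ω → ℝ}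
    (hum : Measurable u) (hpm : Measurable p) (hu : ∀ ω, 0 ≤ u ω) (hp : ∀ ω, 0 ≤ p ω)
    (hui : Integrable u μ) (hpi : Integrable p μ) (hup : ∫ ω, u ω ∂μ = ∫ ω, p ω ∂μ) :
    tvDist (μ.withDensity fun ω => ENNReal.ofReal (u ω))
      (μ.withDensity fun ω => ENNReal.ofReal (p ω)) ≤ 2 * ∫ ω, max (u ω - p ω) 0 ∂μ := by
  have : Nonempty { f : Ω → ℝ // Measurable f ∧ ∀ x, |f x| ≤ 1 } :=
    ⟨⟨fun _ => 0, measurable_const, by simp⟩⟩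
  refine ciSup_le fun ⟨f, hfm, hf⟩ => ?_
  have key : ∀ v : Ω → ℝ, Measurable v → (∀ ω, 0 ≤ v ω) →
      ∫ ω, f ω ∂(μ.withDensity fun ω => ENNReal.ofReal (v ω)) = ∫ ω, v ω * f ω ∂μ := by
    intro v hv h0
    rw [integral_withDensity_eq_integral_toReal_smul hv.ennreal_ofReal (by simp)]
    simp [ENNReal.toReal_ofReal (h0 _)]
  have hint : ∀ v : Ω → ℝ, Integrable v μ → Integrable (fun ω => v ω * f ω) μ := fun v hv =>
    hv.mul_bdd (c := 1) hfm.aestronglyMeasurable (by simpa using ae_of_all _ hf)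
  have hmax : Integrable (fun ω => max (u ω - p ω) 0) μ := (hui.sub hpi).pos_part
  simp only
  rw [key u hum hu, key p hpm hp, ← integral_sub (hint u hui) (hint p hpi)]
  calc |∫ ω, (u ω * f ω - p ω * f ω) ∂μ|
      ≤ ∫ ω, |u ω * f ω - p ω * f ω| ∂μ := abs_integral_le_integral_abs
    _ ≤ ∫ ω, (2 * max (u ω - p ω) 0 - (u ω - p ω)) ∂μ := by
        refine integral_mono ((hint u hui).sub (hint p hpi)).abs
          ((hmax.const_mul 2).sub (hui.sub hpi)) fun ω => ?_
        simp only
        rw [← sub_mul, abs_mul]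
        have h1 : |u ω - p ω| * |f ω| ≤ |u ω - p ω| :=
          mul_le_of_le_one_right (abs_nonneg _) (hf ω)
        rcases le_total (u ω - p ω) 0 with h | h
        · rw [max_eq_right h]; rw [abs_of_nonpos h] at h1 ⊢; linarith
        · rw [max_eq_left h]; rw [abs_of_nonneg h] at h1 ⊢; linarith
    _ = 2 * ∫ ω, max (u ω - p ω) 0 ∂μ := by
        have hui_sub : Integrable (fun ω => u ω - p ω) μ := hui.sub hpi
        rw [integral_sub (hmax.const_mul 2) hui_sub, integral_const_mul,
          integral_sub hui hpi, hup]
        ring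

/-- The kernel `y ↦ ∑ j, w j y • μ j`. -/
noncomputable def mixtureKernel {E Ω J : Type*} [MeasurableSpace E] [MeasurableSpace Ω]
    [Fintype J] (w : J → E → ℝ) (hw : ∀ j, Measurable (w j)) (μ : J → Measure Ω) :
    Kernel E Ω where
  toFun y := ∑ j, ENNReal.ofReal (w j y) • μ j
  measurable' := by
    refine Measure.measurable_of_measurable_coe _ fun s _ => ?_
    simp only [Measure.coe_finsetSum, Finset.sum_apply, Measure.smul_apply, smul_eq_mul]
    exact Finset.measurable_sum _ fun j _ => (hw j).ennreal_ofReal.mul_const _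

theorem isMarkovKernel_mixtureKernel {E Ω J : Type*} [MeasurableSpace E] [MeasurableSpace Ω]
    [Fintype J] {w : J → E → ℝ} (hw : ∀ j, Measurable (w j)) (h0 : ∀ j y, 0 ≤ w j y)
    (h1 : ∀ y, ∑ j, w j y = 1) (μ : J → Measure Ω) [∀ j, IsProbabilityMeasure (μ j)] :
    IsMarkovKernel (mixtureKernel w hw μ) where
  isProbabilityMeasure y := by
    constructor
    change (∑ j, ENNReal.ofReal (w j y) • μ j) Set.univ = 1
    simp only [Measure.coe_finsetSum, Finset.sum_apply, Measure.smul_apply, smul_eq_mul,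
      measure_univ, mul_one]
    rw [← ENNReal.ofReal_sum_of_nonneg fun j _ => h0 j y, h1, ENNReal.ofReal_one]

theorem bind_mixtureKernel {E Ω J : Type*} [MeasurableSpace E] [MeasurableSpace Ω]
    [Fintype J] {w : J → E → ℝ} (hw : ∀ j, Measurable (w j)) (h0 : ∀ j y, 0 ≤ w j y)
    (μ : J → Measure Ω) {Q : Measure E} (hi : ∀ j, Integrable (w j) Q) :
    Q.bind (mixtureKernel w hw μ) = ∑ j, ENNReal.ofReal (∫ y, w j y ∂Q) • μ j := by
  ext s hs
  rw [Measure.bind_apply hs (Kernel.aemeasurable _)]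
  change ∫⁻ y, (∑ j, ENNReal.ofReal (w j y) • μ j) s ∂Q = _
  simp only [Measure.coe_finsetSum, Finset.sum_apply, Measure.smul_apply, smul_eq_mul]
  rw [lintegral_finsetSum _ fun j _ => (hw j).ennreal_ofReal.mul_const _]
  refine Finset.sum_congr rfl fun j _ => ?_
  rw [lintegral_mul_const _ (hw j).ennreal_ofReal,
    ofReal_integral_eq_lintegral_ofReal (hi j) (ae_of_all _ (h0 j))]

open Classical in
/-- The probability measure with density proportional to `v`, or `μ` if `v` has mass zero. -/
noncomputable def reweighted {Ω : Type*} [MeasurableSpace Ω] (μ : Measure Ω) (v : Ω → ℝ) :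
    Measure Ω :=
  if ∫ ω, v ω ∂μ = 0 then μ
  else ENNReal.ofReal (∫ ω, v ω ∂μ)⁻¹ • μ.withDensity fun ω => ENNReal.ofReal (v ω)

theorem isProbabilityMeasure_reweighted {Ω : Type*} [MeasurableSpace Ω] {μ : Measure Ω}
    [IsProbabilityMeasure μ] {v : Ω → ℝ} (h0 : ∀ ω, 0 ≤ v ω) (hi : Integrable v μ) :
    IsProbabilityMeasure (reweighted μ v) := by
  unfold reweighted
  split_ifs with h
  · infer_instance
  · constructor
    have hpos : 0 ≤ ∫ ω, v ω ∂μ := integral_nonneg h0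
    rw [Measure.smul_apply, withDensity_apply _ MeasurableSet.univ, Measure.restrict_univ,
      ← ofReal_integral_eq_lintegral_ofReal hi (ae_of_all _ h0), smul_eq_mul,
      ← ENNReal.ofReal_mul (inv_nonneg.2 hpos), inv_mul_cancel₀ h, ENNReal.ofReal_one]

theorem sum_smul_reweighted {Ω J : Type*} [MeasurableSpace Ω] [Fintype J] {μ : Measure Ω}
    {v : J → Ω → ℝ} (hv : ∀ j, Measurable (v j)) (h0 : ∀ j ω, 0 ≤ v j ω) {a : J → ℝ}
    (ha : ∀ j, 0 ≤ a j) (haz : ∀ j, ∫ ω, v j ω ∂μ = 0 → a j = 0) :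
    ∑ j, ENNReal.ofReal (a j) • reweighted μ (v j) =
      μ.withDensity fun ω => ENNReal.ofReal (∑ j, a j / (∫ ω, v j ω ∂μ) * v j ω) := by
  have hm : ∀ j, 0 ≤ ∫ ω, v j ω ∂μ := fun j => integral_nonneg (h0 j)
  ext s hs
  have hR : ∀ ω, ENNReal.ofReal (∑ j, a j / (∫ ω, v j ω ∂μ) * v j ω) =
      ∑ j, ENNReal.ofReal (a j / (∫ ω, v j ω ∂μ)) * ENNReal.ofReal (v j ω) := by
    intro ω
    rw [ENNReal.ofReal_sum_of_nonneg fun j _ => mul_nonneg (div_nonneg (ha j) (hm j)) (h0 j ω)]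
    exact Finset.sum_congr rfl fun j _ => ENNReal.ofReal_mul (div_nonneg (ha j) (hm j))
  simp only [hR, withDensity_apply _ hs, Measure.coe_finsetSum, Finset.sum_apply,
    Measure.smul_apply, smul_eq_mul]
  rw [lintegral_finsetSum _ fun j _ => (hv j).ennreal_ofReal.const_mul _]
  refine Finset.sum_congr rfl fun j _ => ?_
  rw [lintegral_const_mul _ (hv j).ennreal_ofReal]
  by_cases h : ∫ ω, v j ω ∂μ = 0
  · simp [haz j h]
  · rw [reweighted, if_neg h, Measure.smul_apply, withDensity_apply _ hs, smul_eq_mul, ← mul_assoc,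
      ← ENNReal.ofReal_mul (ha j), div_eq_mul_inv]

universe u

/-- Finitely many continuous nonnegative functions which are integrable can be approximated
from above, in the positive part of `L¹`, by their averages over a continuous finite
partition of unity. -/
theorem exists_partition_average_sub_le {E : Type*} [TopologicalSpace E] [MeasurableSpace E]
    [OpensMeasurableSpace E] (ν : Measure E) [IsProbabilityMeasure ν] {ι : Type u} [Fintype ι]
    (L : ι → E → ℝ) (hLc : ∀ t, Continuous (L t)) (hL0 : ∀ t x, 0 ≤ L t x)
    (hLi : ∀ t, Integrable (L t) ν) {δ : ℝ} (hδ : 0 < δ) :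
    ∃ (J : Type u) (_ : Fintype J) (w : J → E → ℝ), (∀ j, Continuous (w j)) ∧
      (∀ j x, 0 ≤ w j x) ∧ (∀ x, ∑ j, w j x = 1) ∧
      ∀ t, ∫ x, max (∑ j, (∫ y, L t y * w j y ∂ν) / (∫ y, w j y ∂ν) * w j x - L t x) 0 ∂ν
        ≤ 3 * δ := by
  obtain ⟨M, hM0, hM⟩ : ∃ M : ℝ, 0 ≤ M ∧ ∀ t, ∫ x, (L t x - min (L t x) M) ∂ν ≤ δ := by
    have h : ∀ t, ∀ᶠ M : ℝ in atTop, ∫ x, (L t x - min (L t x) M) ∂ν ≤ δ := by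
      intro t
      have ht : Tendsto (fun M : ℝ => ∫ x, (L t x - min (L t x) M) ∂ν) atTop
          (𝓝 (∫ _, (0 : ℝ) ∂ν)) := by
        refine tendsto_integral_filter_of_dominated_convergence (L t) ?_ ?_ (hLi t) ?_
        · exact Eventually.of_forall fun M =>
            ((hLc t).sub ((hLc t).min continuous_const)).measurable.aestronglyMeasurable
        · filter_upwards [eventually_ge_atTop 0] with M hM
          refine ae_of_all _ fun x => ?_
          have h1 : 0 ≤ min (L t x) M := le_min (hL0 t x) hM
          rw [Real.norm_of_nonneg (sub_nonneg.2 (min_le_left _ _))]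
          linarith
        · refine ae_of_all _ fun x => tendsto_const_nhds.congr' ?_
          filter_upwards [eventually_ge_atTop (L t x)] with M hM
          rw [min_eq_left hM, sub_self]
      rw [integral_zero] at ht
      exact (ht.eventually (gt_mem_nhds hδ)).mono fun _ h => h.le
    obtain ⟨M, h1, h2⟩ := ((eventually_ge_atTop (0 : ℝ)).and (eventually_all.2 h)).exists
    exact ⟨M, h1, h2⟩
  have hcpt : IsCompact (Set.Icc (0 : ι → ℝ) fun _ => M) := isCompact_Icc
  obtain ⟨T, -, hTfin, hT⟩ := hcpt.finite_cover_balls hδ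
  have : Fintype T := hTfin.fintype
  obtain ⟨ρ, hρ⟩ := PartitionOfUnity.exists_isSubordinate_of_locallyFinite hcpt.isClosed
    (fun j : T => Metric.ball (j : ι → ℝ) δ) (fun _ => Metric.isOpen_ball)
    (locallyFinite_of_finite _) (by simpa [Set.iUnion_subtype] using hT)
  let F : E → ι → ℝ := fun x t => min (L t x) M
  have hFc : Continuous F := continuous_pi fun t => (hLc t).min continuous_const
  have hFL : ∀ x t, F x t ≤ L t x := fun x t => min_le_left _ _
  have hF0 : ∀ x t, 0 ≤ F x t := fun x t => le_min (hL0 t x) hM0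
  let w : T → E → ℝ := fun j x => ρ j (F x)
  have hwc : ∀ j, Continuous (w j) := fun j => (ρ j).continuous.comp hFc
  have hw0 : ∀ j x, 0 ≤ w j x := fun j x => ρ.nonneg j _
  have hw1 : ∀ x, ∑ j, w j x = 1 := by
    intro x
    rw [← ρ.sum_eq_one (x := F x) ⟨hF0 x, fun t => min_le_right _ _⟩,
      finsum_eq_sum_of_fintype]
  have hwle : ∀ j x, w j x ≤ 1 := fun j x => ρ.le_one j _
  have hosc : ∀ j x t, w j x ≠ 0 → |F x t - (j : ι → ℝ) t| ≤ δ := by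
    intro j x t h
    have hb : F x ∈ Metric.ball (j : ι → ℝ) δ := hρ j (subset_tsupport _ h)
    exact (dist_le_pi_dist (F x) j t).trans (Metric.mem_ball.1 hb).le
  refine ⟨T, inferInstance, w, hwc, hw0, hw1, fun t => ?_⟩
  have hmul : ∀ j, ∀ {v : E → ℝ}, Integrable v ν → Integrable (fun x => v x * w j x) ν :=
    fun j v hv => hv.mul_bdd (c := 1) (hwc j).measurable.aestronglyMeasurable
      (ae_of_all _ fun x => by rw [Real.norm_of_nonneg (hw0 j x)]; exact hwle j x)
  have hwi : ∀ j, Integrable (w j) ν := fun j => by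
    simpa using hmul j (integrable_const (1 : ℝ))
  have hFi : Integrable (fun x => F x t) ν :=
    (hLi t).mono ((continuous_apply t).comp hFc).measurable.aestronglyMeasurable
      (ae_of_all _ fun x => by
        rw [Real.norm_of_nonneg (hF0 x t), Real.norm_of_nonneg (hL0 t x)]; exact hFL x t)
  have hLFi : Integrable (fun x => L t x - F x t) ν := (hLi t).sub hFi
  set q : T → ℝ := fun j => ∫ y, w j y ∂ν with hq
  set A : T → ℝ := fun j => ∫ y, L t y * w j y ∂ν with hA
  let r : T → ℝ := fun j => max (A j / q j - (j : ι → ℝ) t + δ) 0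
  have hq0 : ∀ j, 0 ≤ q j := fun j => integral_nonneg (hw0 j)
  have hsumi : Integrable (fun x => ∑ j, r j * w j x) ν :=
    integrable_finsetSum _ fun j _ => (hwi j).const_mul _
  have hpt : ∀ x, max (∑ j, A j / q j * w j x - L t x) 0 ≤ ∑ j, r j * w j x := by
    intro x
    refine max_le ?_ (Finset.sum_nonneg fun j _ => mul_nonneg (le_max_right _ _) (hw0 j x))
    have h1 : F x t = ∑ j, F x t * w j x := by rw [← Finset.mul_sum, hw1, mul_one]
    have h2 : ∑ j, A j / q j * w j x - F x t ≤ ∑ j, r j * w j x := by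
      conv_lhs => rw [h1]
      rw [← Finset.sum_sub_distrib]
      refine Finset.sum_le_sum fun j _ => ?_
      by_cases h : w j x = 0
      · simp [h]
      · rw [← sub_mul]
        refine mul_le_mul_of_nonneg_right (le_max_of_le_left ?_) (hw0 j x)
        linarith [(abs_le.1 (hosc j x t h)).1]
    linarith [hFL x t]
  have hqr : ∀ j, r j * q j ≤ ∫ x, (L t x - F x t) * w j x ∂ν + 2 * δ * q j := by
    intro j
    have hnn : 0 ≤ ∫ x, (L t x - F x t) * w j x ∂ν :=
      integral_nonneg fun x => mul_nonneg (sub_nonneg.2 (hFL x t)) (hw0 j x)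
    have hrhs : 0 ≤ ∫ x, (L t x - F x t) * w j x ∂ν + 2 * δ * q j := by
      have := hq0 j; positivity
    by_cases h : q j = 0
    · rw [h] at hrhs ⊢; simpa using hrhs
    · have hFw : ∫ x, F x t * w j x ∂ν ≤ ((j : ι → ℝ) t + δ) * q j := by
        rw [hq, ← integral_const_mul]
        refine integral_mono (hmul j hFi) ((hwi j).const_mul _) fun x => ?_
        by_cases h : w j x = 0
        · simp [h]
        · refine mul_le_mul_of_nonneg_right ?_ (hw0 j x)
          linarith [(abs_le.1 (hosc j x t h)).2]
      have hAe : A j = ∫ x, (L t x - F x t) * w j x ∂ν + ∫ x, F x t * w j x ∂ν := by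
        rw [← integral_add (hmul j hLFi) (hmul j hFi)]
        simp only [hA]
        congr 1 with x
        ring
      rw [max_mul_of_nonneg _ _ (hq0 j), zero_mul]
      refine max_le ?_ hrhs
      have : (A j / q j - (j : ι → ℝ) t + δ) * q j = A j - ((j : ι → ℝ) t - δ) * q j := by
        field_simp
        ring
      rw [this, hAe]
      linarith
  have hqs : ∑ j, q j = 1 := by
    rw [hq, ← integral_finsetSum _ fun j _ => hwi j]
    simp [hw1]
  have hLFs : ∑ j, ∫ x, (L t x - F x t) * w j x ∂ν = ∫ x, (L t x - F x t) ∂ν := by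
    rw [← integral_finsetSum _ fun j _ => hmul j hLFi]
    simp [← Finset.mul_sum, hw1]
  calc ∫ x, max (∑ j, A j / q j * w j x - L t x) 0 ∂ν
      ≤ ∫ x, ∑ j, r j * w j x ∂ν :=
        integral_mono (((integrable_finsetSum _ fun j _ => (hwi j).const_mul _).sub
          (hLi t)).pos_part) hsumi hpt
    _ = ∑ j, r j * q j := by
        rw [integral_finsetSum _ fun j _ => (hwi j).const_mul _]
        simp only [integral_const_mul, hq]
    _ ≤ ∑ j, (∫ x, (L t x - F x t) * w j x ∂ν + 2 * δ * q j) :=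
        Finset.sum_le_sum fun j _ => hqr j
    _ ≤ 3 * δ := by
        rw [Finset.sum_add_distrib, ← Finset.mul_sum, hqs, hLFs]
        linarith [hM t]

theorem integrable_and_integral_eq_one_of_withDensity {Ω : Type*} [MeasurableSpace Ω]
    {μ : Measure Ω} {v : Ω → ℝ} (hv : Measurable v) (h0 : ∀ ω, 0 ≤ v ω)
    (h : IsProbabilityMeasure (μ.withDensity fun ω => ENNReal.ofReal (v ω))) :
    Integrable v μ ∧ ∫ ω, v ω ∂μ = 1 := by
  have h1 : ∫⁻ ω, ENNReal.ofReal (v ω) ∂μ = 1 := by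
    have := h.measure_univ
    rwa [withDensity_apply _ MeasurableSet.univ, Measure.restrict_univ] at this
  have hi : Integrable v μ := by
    refine ⟨hv.aestronglyMeasurable, ?_⟩
    rw [hasFiniteIntegral_iff_ofReal (ae_of_all _ h0), h1]
    exact ENNReal.one_lt_top
  refine ⟨hi, ?_⟩
  rw [integral_eq_lintegral_of_nonneg_ae (ae_of_all _ h0) hv.aestronglyMeasurable, h1,
    ENNReal.toReal_one]

/-- Total variation bound, for a single sample size, between a law `Q` pushed
through the mixture kernel and the law with density `(1 + e) L(X)`. -/
theorem tvDist_bind_mixtureKernel_le {E Ω J : Type*} [MeasurableSpace E] [MeasurableSpace Ω]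
    [Fintype J] {μ : Measure Ω} [IsProbabilityMeasure μ] {X : Ω → E} (hX : Measurable X)
    {w : J → E → ℝ} (hw : ∀ j, Measurable (w j)) (hw0 : ∀ j y, 0 ≤ w j y)
    (hw1 : ∀ y, ∑ j, w j y = 1) {Q : Measure E} [IsProbabilityMeasure Q]
    {L : E → ℝ} (hLm : Measurable L) (hL0 : ∀ x, 0 ≤ L x) {e : Ω → ℝ} (he : Measurable e)
    (hP : IsProbabilityMeasure
      (μ.withDensity fun ω => ENNReal.ofReal ((1 + e ω) * L (X ω))))
    (hm : ∀ j, ∫ ω, w j (X ω) ∂μ = 0 → ∫ y, w j y ∂Q = 0)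
    {c : J → ℝ} (hc : ∀ j, 0 ≤ c j) {η : ℝ} (hη : η ≤ 1) :
    tvDist (Q.bind (mixtureKernel w hw fun j => reweighted μ fun ω => w j (X ω)))
        (μ.withDensity fun ω => ENNReal.ofReal ((1 + e ω) * L (X ω))) ≤
      2 * (∑ j, |(∫ y, w j y ∂Q) / (∫ ω, w j (X ω) ∂μ) - c j|
        + ∫ ω, max (∑ j, c j * w j (X ω) - (1 - η) * L (X ω)) 0 ∂μ
        + (∑ j, c j) * μ.real {ω | η ≤ |e ω|}) := by
  have hwle : ∀ j x, w j x ≤ 1 := fun j x => by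
    rw [← hw1 x]
    exact Finset.single_le_sum (fun i _ => hw0 i x) (Finset.mem_univ j)
  have hwb : ∀ j x, ‖w j x‖ ≤ 1 := fun j x => by
    rw [Real.norm_of_nonneg (hw0 j x)]; exact hwle j x
  have hwQ : ∀ j, Integrable (w j) Q := fun j =>
    .of_bound (hw j).aestronglyMeasurable 1 (ae_of_all _ (hwb j))
  have hwX : ∀ j, Measurable fun ω => w j (X ω) := fun j => (hw j).comp hX
  have hwμ : ∀ j, Integrable (fun ω => w j (X ω)) μ := fun j =>
    .of_bound (hwX j).aestronglyMeasurable 1 (ae_of_all _ fun ω => hwb j (X ω))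
  have hmean : ∀ j, 0 ≤ ∫ ω, w j (X ω) ∂μ := fun j => integral_nonneg fun ω => hw0 j (X ω)
  have hQ0 : ∀ j, 0 ≤ ∫ y, w j y ∂Q := fun j => integral_nonneg (hw0 j)
  set b : J → ℝ := fun j => (∫ y, w j y ∂Q) / (∫ ω, w j (X ω) ∂μ) with hb
  have hb0 : ∀ j, 0 ≤ b j := fun j => div_nonneg (hQ0 j) (hmean j)
  have hmax : (fun ω => ENNReal.ofReal ((1 + e ω) * L (X ω))) =
      fun ω => ENNReal.ofReal (max ((1 + e ω) * L (X ω)) 0) := by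
    ext ω
    rcases le_total ((1 + e ω) * L (X ω)) 0 with h | h
    · rw [max_eq_right h, ENNReal.ofReal_of_nonpos h, ENNReal.ofReal_zero]
    · rw [max_eq_left h]
  rw [hmax] at hP ⊢
  set p : Ω → ℝ := fun ω => max ((1 + e ω) * L (X ω)) 0
  have hpm : Measurable p :=
    ((measurable_const.add he).mul (hLm.comp hX)).max measurable_const
  have hp0 : ∀ ω, 0 ≤ p ω := fun ω => le_max_right _ _
  obtain ⟨hpi, hp1⟩ := integrable_and_integral_eq_one_of_withDensity hpm hp0 hP
  have hci : ∀ a : J → ℝ, Integrable (fun ω => ∑ j, a j * w j (X ω)) μ := fun a =>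
    integrable_finsetSum _ fun j _ => (hwμ j).const_mul _
  have hcm : ∀ a : J → ℝ, Measurable fun ω => ∑ j, a j * w j (X ω) := fun a =>
    Finset.measurable_sum _ fun j _ => (hwX j).const_mul _
  have hb1 : ∫ ω, ∑ j, b j * w j (X ω) ∂μ = 1 := by
    rw [integral_finsetSum _ fun j _ => (hwμ j).const_mul _]
    calc ∑ j, ∫ ω, b j * w j (X ω) ∂μ = ∑ j, ∫ y, w j y ∂Q := by
          refine Finset.sum_congr rfl fun j _ => ?_
          rw [integral_const_mul]
          exact div_mul_cancel_of_imp (hm j)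
      _ = 1 := by
          rw [← integral_finsetSum _ fun j _ => hwQ j]
          simp [hw1]
  rw [bind_mixtureKernel hw hw0 _ hwQ,
    sum_smul_reweighted hwX (fun j ω => hw0 j (X ω)) hQ0 hm]
  refine (tvDist_withDensity_le (hcm b) hpm
    (fun ω => Finset.sum_nonneg fun j _ => mul_nonneg (hb0 j) (hw0 j _)) hp0 (hci b) hpi
    (hb1.trans hp1.symm)).trans ?_
  refine mul_le_mul_of_nonneg_left ?_ zero_le_two
  have hset : MeasurableSet {ω | η ≤ |e ω|} := measurableSet_le measurable_const he.abs
  have hhi : Integrable (fun ω => max (∑ j, c j * w j (X ω) - (1 - η) * L (X ω)) 0) μ := by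
    refine (hci c).mono (((hcm c).sub ((hLm.comp hX).const_mul _)).max
      measurable_const).aestronglyMeasurable (ae_of_all _ fun ω => ?_)
    have h1 : 0 ≤ ∑ j, c j * w j (X ω) :=
      Finset.sum_nonneg fun j _ => mul_nonneg (hc j) (hw0 j _)
    rw [Real.norm_of_nonneg (le_max_right _ _), Real.norm_of_nonneg h1]
    have := mul_nonneg (sub_nonneg.2 hη) (hL0 (X ω))
    exact max_le (by linarith) h1
  have hind : Integrable ({ω | η ≤ |e ω|}.indicator fun _ => ∑ j, c j) μ :=
    (integrable_const _).indicator hset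
  have hpt : ∀ ω, max (∑ j, b j * w j (X ω) - p ω) 0 ≤ ∑ j, |b j - c j|
      + max (∑ j, c j * w j (X ω) - (1 - η) * L (X ω)) 0
      + {ω | η ≤ |e ω|}.indicator (fun _ => ∑ j, c j) ω := by
    intro ω
    have hC : 0 ≤ ∑ j, c j := Finset.sum_nonneg fun j _ => hc j
    have h1 : ∑ j, b j * w j (X ω) - ∑ j, c j * w j (X ω) ≤ ∑ j, |b j - c j| := by
      rw [← Finset.sum_sub_distrib]
      refine Finset.sum_le_sum fun j _ => ?_
      rw [← sub_mul]
      calc (b j - c j) * w j (X ω) ≤ |b j - c j| * w j (X ω) :=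
            mul_le_mul_of_nonneg_right (le_abs_self _) (hw0 j _)
        _ ≤ |b j - c j| := mul_le_of_le_one_right (abs_nonneg _) (hwle j _)
    have h2 : 0 ≤ ∑ j, |b j - c j| := Finset.sum_nonneg fun j _ => abs_nonneg _
    have h3 : ∑ j, c j * w j (X ω) ≤ ∑ j, c j :=
      Finset.sum_le_sum fun j _ => mul_le_of_le_one_right (hc j) (hwle j _)
    have h4 := le_max_right (∑ j, c j * w j (X ω) - (1 - η) * L (X ω)) 0
    have h5 := le_max_left (∑ j, c j * w j (X ω) - (1 - η) * L (X ω)) 0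
    by_cases h : η ≤ |e ω|
    · rw [Set.indicator_of_mem (s := {ω | η ≤ |e ω|}) h]
      exact max_le (by linarith [hp0 ω]) (by linarith)
    · rw [Set.indicator_of_notMem (s := {ω | η ≤ |e ω|}) h]
      have h6 : (1 - η) * L (X ω) ≤ p ω := by
        refine le_trans (mul_le_mul_of_nonneg_right ?_ (hL0 _)) (le_max_left _ _)
        linarith [(abs_lt.1 (not_le.1 h)).1]
      exact max_le (by linarith) (by linarith)
  calc ∫ ω, max (∑ j, b j * w j (X ω) - p ω) 0 ∂μ
      ≤ ∫ ω, (∑ j, |b j - c j| + max (∑ j, c j * w j (X ω) - (1 - η) * L (X ω)) 0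
        + {ω | η ≤ |e ω|}.indicator (fun _ => ∑ j, c j) ω) ∂μ :=
        integral_mono (((hci b).sub hpi).pos_part)
          (((integrable_const _).add hhi).add hind) hpt
    _ = _ := by
        have hsum : Integrable (fun ω => ∑ j, |b j - c j|
            + max (∑ j, c j * w j (X ω) - (1 - η) * L (X ω)) 0) μ :=
          (integrable_const _).add hhi
        rw [integral_add hsum hind,
          integral_add (integrable_const _) hhi, integral_indicator_const _ hset]
        simp [mul_comm, hb]

/-- Weak convergence of the statistics `X n` under the base measures, together with likelihood
ratios asymptotically equivalent to `L t (X n)`, gives kernels which approximately transport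
the finite limit experiment `ν.withDensity (L t)` to the given ones. -/
theorem exists_kernel_eventually_tvDist_le {E : Type*} [TopologicalSpace E] [MeasurableSpace E]
    [OpensMeasurableSpace E] {ν : Measure E} [IsProbabilityMeasure ν] {ι : Type u} [Fintype ι]
    {L : ι → E → ℝ} (hLc : ∀ t, Continuous (L t)) (hL0 : ∀ t x, 0 ≤ L t x)
    (hQ : ∀ t, IsProbabilityMeasure (ν.withDensity fun x => ENNReal.ofReal (L t x)))
    {Ω : ℕ → Type*} [∀ n, MeasurableSpace (Ω n)] {μ : (n : ℕ) → Measure (Ω n)}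
    [∀ n, IsProbabilityMeasure (μ n)] {X : (n : ℕ) → Ω n → E} (hX : ∀ n, Measurable (X n))
    {e : (n : ℕ) → ι → Ω n → ℝ} (he : ∀ n t, Measurable (e n t))
    (hP : ∀ n t, IsProbabilityMeasure
      ((μ n).withDensity fun ω => ENNReal.ofReal ((1 + e n t ω) * L t (X n ω))))
    (hXconv : ∀ f : BoundedContinuousFunction E ℝ,
      Tendsto (fun n => ∫ ω, f (X n ω) ∂(μ n)) atTop (𝓝 (∫ x, f x ∂ν)))
    (heconv : ∀ t, ∀ η : ℝ, 0 < η →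
      Tendsto (fun n => μ n {ω | η ≤ |e n t ω|}) atTop (𝓝 0)) {δ : ℝ} (hδ : 0 < δ) :
    ∃ K : (n : ℕ) → Kernel E (Ω n), (∀ n, IsMarkovKernel (K n)) ∧
      ∀ᶠ n in atTop, ∀ t, tvDist ((ν.withDensity fun x => ENNReal.ofReal (L t x)).bind (K n))
        ((μ n).withDensity fun ω => ENNReal.ofReal ((1 + e n t ω) * L t (X n ω))) ≤ δ := by
  have hL : ∀ t, Integrable (L t) ν ∧ ∫ x, L t x ∂ν = 1 := fun t =>
    integrable_and_integral_eq_one_of_withDensity (hLc t).measurable (hL0 t) (hQ t)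
  obtain ⟨η, hη0, hη1, hηδ⟩ : ∃ η : ℝ, 0 < η ∧ η ≤ 1 ∧ 2 * (4 * η) < δ :=
    ⟨min 1 (δ / 9), by positivity, min_le_left _ _, by
      linarith [min_le_right 1 (δ / 9)]⟩
  obtain ⟨J, _, w, hwc, hw0, hw1, hwL⟩ :=
    exists_partition_average_sub_le ν L hLc hL0 (fun t => (hL t).1) hη0
  have hwle : ∀ j x, w j x ≤ 1 := fun j x => by
    rw [← hw1 x]
    exact Finset.single_le_sum (fun i _ => hw0 i x) (Finset.mem_univ j)
  have hwb : ∀ j x, ‖w j x‖ ≤ 1 := fun j x => by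
    rw [Real.norm_of_nonneg (hw0 j x)]; exact hwle j x
  have hwi : ∀ j, Integrable (w j) ν := fun j =>
    .of_bound (hwc j).measurable.aestronglyMeasurable 1 (ae_of_all _ (hwb j))
  have hwm : ∀ j, Measurable (w j) := fun j => (hwc j).measurable
  have hwX : ∀ n j, Integrable (fun ω => w j (X n ω)) (μ n) := fun n j =>
    .of_bound ((hwm j).comp (hX n)).aestronglyMeasurable 1 (ae_of_all _ fun ω => hwb j (X n ω))
  have hQw : ∀ t j, ∫ x, w j x ∂(ν.withDensity fun x => ENNReal.ofReal (L t x)) =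
      ∫ x, L t x * w j x ∂ν := by
    intro t j
    rw [integral_withDensity_eq_integral_toReal_smul (hLc t).measurable.ennreal_ofReal (by simp)]
    simp [ENNReal.toReal_ofReal (hL0 t _)]
  have hzero : ∀ t j, ∫ x, w j x ∂ν = 0 → ∫ x, L t x * w j x ∂ν = 0 := by
    intro t j h
    rw [integral_eq_zero_iff_of_nonneg (hw0 j) (hwi j)] at h
    refine integral_eq_zero_of_ae (h.mono fun x hx => ?_)
    simp only [Pi.zero_apply] at hx ⊢
    rw [hx, mul_zero]
  have hmconv : ∀ j, Tendsto (fun n => ∫ ω, w j (X n ω) ∂(μ n)) atTop (𝓝 (∫ x, w j x ∂ν)) :=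
    fun j => hXconv (.ofNormedAddCommGroup (w j) (hwc j) 1 (hwb j))
  refine ⟨fun n => mixtureKernel w hwm fun j => reweighted (μ n) fun ω => w j (X n ω),
    fun n => ?_, ?_⟩
  · have : ∀ j, IsProbabilityMeasure (reweighted (μ n) fun ω => w j (X n ω)) := fun j =>
      isProbabilityMeasure_reweighted (fun ω => hw0 j _) (hwX n j)
    exact isMarkovKernel_mixtureKernel hwm hw0 hw1 _
  refine eventually_all.2 fun t => ?_
  set c : J → ℝ := fun j => (∫ y, L t y * w j y ∂ν) / (∫ y, w j y ∂ν) with hc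
  have hc0 : ∀ j, 0 ≤ c j := fun j =>
    div_nonneg (integral_nonneg fun x => mul_nonneg (hL0 t x) (hw0 j x)) (integral_nonneg (hw0 j))
  have hgood : ∀ᶠ n in atTop, ∀ j, ∫ ω, w j (X n ω) ∂(μ n) = 0 →
      ∫ x, L t x * w j x ∂ν = 0 := by
    refine eventually_all.2 fun j => ?_
    by_cases h : ∫ x, w j x ∂ν = 0
    · exact Eventually.of_forall fun _ _ => hzero t j h
    · exact ((hmconv j).eventually_ne h).mono fun n hn h0 => absurd h0 hn
  have hbconv : ∀ j, Tendsto (fun n => |(∫ x, L t x * w j x ∂ν) / (∫ ω, w j (X n ω) ∂(μ n)) - c j|)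
      atTop (𝓝 0) := by
    intro j
    by_cases h : ∫ x, w j x ∂ν = 0
    · simp [hc, hzero t j h]
    · have := ((tendsto_const_nhds (x := ∫ x, L t x * w j x ∂ν)).div (hmconv j) h).sub_const (c j)
      simpa [hc] using this.abs
  let g : E → ℝ := fun x => max (∑ j, c j * w j x - (1 - η) * L t x) 0
  have hgc : Continuous g :=
    ((continuous_finsetSum _ fun j _ => continuous_const.mul (hwc j)).sub
      (continuous_const.mul (hLc t))).max continuous_const
  have hgb : ∀ x, ‖g x‖ ≤ ∑ j, c j := by
    intro x
    rw [Real.norm_of_nonneg (le_max_right _ _)]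
    refine max_le ?_ (Finset.sum_nonneg fun j _ => hc0 j)
    have h3 : ∑ j, c j * w j x ≤ ∑ j, c j :=
      Finset.sum_le_sum fun j _ => mul_le_of_le_one_right (hc0 j) (hwle j _)
    have := mul_nonneg (sub_nonneg.2 hη1) (hL0 t x)
    linarith
  have hgconv : Tendsto (fun n => ∫ ω, g (X n ω) ∂(μ n)) atTop (𝓝 (∫ x, g x ∂ν)) :=
    hXconv (.ofNormedAddCommGroup g hgc (∑ j, c j) hgb)
  have hci : Integrable (fun x => ∑ j, c j * w j x) ν :=
    integrable_finsetSum _ fun j _ => (hwi j).const_mul _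
  have hgle : ∫ x, g x ∂ν ≤ 4 * η := by
    have hi1 : Integrable (fun x => max (∑ j, c j * w j x - L t x) 0) ν :=
      (hci.sub (hL t).1).pos_part
    calc ∫ x, g x ∂ν ≤ ∫ x, (max (∑ j, c j * w j x - L t x) 0 + η * L t x) ∂ν := by
          refine integral_mono (hci.sub ((hL t).1.const_mul _)).pos_part
            (hi1.add ((hL t).1.const_mul _)) fun x => ?_
          have h1 := le_max_left (∑ j, c j * w j x - L t x) 0
          have h2 := le_max_right (∑ j, c j * w j x - L t x) 0
          have h3 := mul_nonneg hη0.le (hL0 t x)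
          exact max_le (by linarith) (by linarith)
      _ ≤ 4 * η := by
          rw [integral_add hi1 ((hL t).1.const_mul _), integral_const_mul, (hL t).2]
          linarith [hwL t]
  have hereal : Tendsto (fun n => (μ n).real {ω | η ≤ |e n t ω|}) atTop (𝓝 0) := by
    simpa [Measure.real, Function.comp_def] using
      (ENNReal.tendsto_toReal ENNReal.zero_ne_top).comp (heconv t η hη0)
  have hlim := (((tendsto_finsetSum Finset.univ fun j _ => hbconv j).add hgconv).add
    (hereal.const_mul (∑ j, c j))).const_mul 2
  have hlt : 2 * (∑ _j : J, (0 : ℝ) + ∫ x, g x ∂ν + (∑ j, c j) * 0) < δ := by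
    rw [Finset.sum_const_zero]
    linarith
  filter_upwards [hlim.eventually (gt_mem_nhds hlt), hgood] with n hn hgn
  have := hQ t
  refine (tvDist_bind_mixtureKernel_le (hX n) hwm hw0 hw1 (hLc t).measurable (hL0 t) (he n t)
    (hP n t) (by simpa only [hQw] using hgn) hc0 hη1).trans ?_
  simp only [hQw]
  exact hn.le

theorem gaussianReal_eq_withDensity_exp (t : ℝ) :
    gaussianReal t 1 = (gaussianReal 0 1).withDensity fun x =>
      ENNReal.ofReal (Real.exp (t * x - t ^ 2 / 2)) := by
  have hm : Measurable fun x : ℝ => ENNReal.ofReal (Real.exp (t * x - t ^ 2 / 2)) := by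
    fun_prop
  rw [gaussianReal_of_var_ne_zero _ one_ne_zero, gaussianReal_of_var_ne_zero _ one_ne_zero,
    ← withDensity_mul _ (measurable_gaussianPDF _ _) hm]
  congr 1 with x
  rw [Pi.mul_apply, gaussianPDF, gaussianPDF, ← ENNReal.ofReal_mul (gaussianPDFReal_nonneg _ _ _),
    gaussianPDFReal, gaussianPDFReal, mul_assoc _ (Real.exp _), ← Real.exp_add]
  congr 3
  push_cast
  ring

theorem pi_gaussianReal_eq_withDensity_exp {d : ℕ} (t : Fin d → ℝ) :
    (Measure.pi fun i => gaussianReal (t i) 1) =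
      (Measure.pi fun _ : Fin d => gaussianReal 0 1).withDensity fun x =>
        ENNReal.ofReal (Real.exp ((∑ i, t i * x i) - (∑ i, t i ^ 2) / 2)) := by
  refine Measure.pi_eq (fun s hs => ?_)
  have hint : ∀ i, Integrable (fun x : ℝ => Real.exp (t i * x - t i ^ 2 / 2))
      ((gaussianReal 0 1).restrict (s i)) := fun i =>
    (integrable_and_integral_eq_one_of_withDensity (by fun_prop) (fun _ => (Real.exp_pos _).le)
      (by rw [← gaussianReal_eq_withDensity_exp]; infer_instance)).1.restrict
  have hprod : ∀ x : Fin d → ℝ, Real.exp ((∑ i, t i * x i) - (∑ i, t i ^ 2) / 2) =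
      ∏ i, Real.exp (t i * x i - t i ^ 2 / 2) := by
    intro x
    rw [← Real.exp_sum, Finset.sum_sub_distrib, Finset.sum_div]
  rw [withDensity_apply _ (MeasurableSet.univ_pi hs), Measure.restrict_pi_pi]
  simp only [hprod]
  rw [← ofReal_integral_eq_lintegral_ofReal (Integrable.fintype_prod_dep hint)
      (ae_of_all _ fun x => Finset.prod_nonneg fun i _ => (Real.exp_pos _).le),
    integral_fintype_prod_eq_prod (fun i x => Real.exp (t i * x - t i ^ 2 / 2)),
    ENNReal.ofReal_prod_of_nonneg fun i _ => integral_nonneg fun x => (Real.exp_pos _).le]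
  refine Finset.prod_congr rfl fun i _ => ?_
  rw [gaussianReal_eq_withDensity_exp (t i), withDensity_apply _ (hs i),
    ofReal_integral_eq_lintegral_ofReal (hint i) (ae_of_all _ fun x => (Real.exp_pos _).le)]

theorem tvDist_nonneg {α : Type*} [MeasurableSpace α] (μ ν : Measure α) : 0 ≤ tvDist μ ν :=
  Real.iSup_nonneg fun _ => abs_nonneg _

/-- **Local asymptotic normality implies weak convergence to the Gaussian shift
experiment.**  If `dP_{n,t}/dP_{n,0} = (1 + εₙ(t)) exp(t'Zₙ − |t|²/2)` with
`Zₙ →d N(0, I_d)` under `P_{n,0}` and `εₙ(t) → 0` in `P_{n,0}`-probability, then for every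
finite `S ⊆ ℝᵈ` there are Markov kernels `Kₙ` from `ℝᵈ` to `Ωₙ` with
`max_{t ∈ S} ‖N(t, I_d) Kₙ − P_{n,t}‖₁ → 0`.  (Here `ℝᵈ` is `Fin d → ℝ`, and `N(t, I_d)`
is the product measure `⊗ᵢ N(t i, 1)`.) -/
theorem statement12 {d : ℕ} (hd : 1 ≤ d)
    {Ω : ℕ → Type*} [∀ n, MeasurableSpace (Ω n)]
    (P : (n : ℕ) → (Fin d → ℝ) → Measure (Ω n))
    [∀ n t, IsProbabilityMeasure (P n t)]
    (Z : (n : ℕ) → Ω n → Fin d → ℝ) (hZ : ∀ n, Measurable (Z n))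
    (e : (n : ℕ) → (Fin d → ℝ) → Ω n → ℝ) (he : ∀ n t, Measurable (e n t))
    -- local asymptotic normality: the likelihood ratio of `P_{n,t}` w.r.t. `P_{n,0}`
    (hLAN : ∀ n t, P n t = (P n 0).withDensity fun ω =>
        ENNReal.ofReal ((1 + e n t ω) *
          Real.exp ((∑ i, t i * Z n ω i) - (∑ i, t i ^ 2) / 2)))
    -- `Zₙ` converges in distribution under `P_{n,0}` to `N(0, I_d)`
    (hZconv : ∀ f : BoundedContinuousFunction (Fin d → ℝ) ℝ,
        Tendsto (fun n => ∫ ω, f (Z n ω) ∂(P n 0)) atTop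
          (𝓝 (∫ x, f x ∂(Measure.pi fun _ : Fin d => gaussianReal 0 1))))
    -- `εₙ(t) → 0` in `P_{n,0}`-probability, for each fixed `t`
    (heconv : ∀ t : Fin d → ℝ, ∀ η : ℝ, 0 < η →
        Tendsto (fun n => P n 0 {ω | η ≤ |e n t ω|}) atTop (𝓝 0)) :
    ∀ S : Finset (Fin d → ℝ),
      ∃ K : (n : ℕ) → Kernel (Fin d → ℝ) (Ω n), (∀ n, IsMarkovKernel (K n)) ∧
        Tendsto (fun n => ⨆ t ∈ S,
            tvDist ((Measure.pi fun i => gaussianReal (t i) 1).bind (K n)) (P n t))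
          atTop (𝓝 0) := by
  intro S
  let L : S → (Fin d → ℝ) → ℝ := fun t x =>
    Real.exp ((∑ i, t.1 i * x i) - (∑ i, t.1 i ^ 2) / 2)
  let ν : Measure (Fin d → ℝ) := Measure.pi fun _ => gaussianReal 0 1
  have hQ : ∀ t : S, IsProbabilityMeasure (ν.withDensity fun x => ENNReal.ofReal (L t x)) := by
    intro t
    rw [← pi_gaussianReal_eq_withDensity_exp]
    infer_instance
  have hP : ∀ n (t : S), IsProbabilityMeasure ((P n 0).withDensity fun ω =>
      ENNReal.ofReal ((1 + e n t ω) * L t (Z n ω))) := by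
    intro n t
    rw [← hLAN]
    infer_instance
  have hkey : ∀ δ : ℝ, 0 < δ → ∃ K : (n : ℕ) → Kernel (Fin d → ℝ) (Ω n),
      (∀ n, IsMarkovKernel (K n)) ∧ ∀ᶠ n in atTop, ⨆ t ∈ S,
        tvDist ((Measure.pi fun i => gaussianReal (t i) 1).bind (K n)) (P n t) ≤ δ := by
    intro δ hδ
    obtain ⟨K, hK, hKt⟩ := exists_kernel_eventually_tvDist_le (L := L) (ν := ν)
      (fun t => by fun_prop) (fun t x => (Real.exp_pos _).le) hQ hZ
      (e := fun n t => e n t) (fun n t => he n t) hP hZconv (fun t => heconv t) hδ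
    refine ⟨K, hK, hKt.mono fun n hn => ?_⟩
    refine Real.iSup_le (fun t => Real.iSup_le (fun ht => ?_) hδ.le) hδ.le
    rw [pi_gaussianReal_eq_withDensity_exp, hLAN n t]
    exact hn ⟨t, ht⟩
  let v : (n : ℕ) → { κ : Kernel (Fin d → ℝ) (Ω n) // IsMarkovKernel κ } → ℝ := fun n κ =>
    ⨆ t ∈ S, tvDist ((Measure.pi fun i => gaussianReal (t i) 1).bind κ.1) (P n t)
  have hv0 : ∀ n κ, 0 ≤ v n κ := fun n κ =>
    Real.iSup_nonneg fun _ => Real.iSup_nonneg fun _ => tvDist_nonneg _ _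
  have hbdd : ∀ n, BddBelow (Set.range (v n)) := fun n => ⟨0, by rintro _ ⟨κ, rfl⟩; exact hv0 n κ⟩
  obtain ⟨K₁, hK₁, -⟩ := hkey 1 one_pos
  have hne : ∀ n, Nonempty { κ : Kernel (Fin d → ℝ) (Ω n) // IsMarkovKernel κ } :=
    fun n => ⟨⟨K₁ n, hK₁ n⟩⟩
  have hinf : Tendsto (fun n => ⨅ κ, v n κ) atTop (𝓝 0) := by
    rw [Metric.tendsto_nhds]
    intro δ hδ
    obtain ⟨K, hK, hKt⟩ := hkey (δ / 2) (half_pos hδ)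
    filter_upwards [hKt] with n hn
    rw [Real.dist_eq, sub_zero, abs_of_nonneg (Real.iInf_nonneg (hv0 n))]
    exact ((ciInf_le (hbdd n) ⟨K n, hK n⟩).trans hn).trans_lt (half_lt_self hδ)
  have hex : ∀ n : ℕ, ∃ κ, v n κ < (⨅ κ, v n κ) + 1 / ((n : ℝ) + 1) := fun n =>
    exists_lt_of_ciInf_lt (lt_add_of_pos_right _ Nat.one_div_pos_of_nat)
  choose κ hκ using hex
  refine ⟨fun n => (κ n).1, fun n => (κ n).2, ?_⟩
  refine squeeze_zero (fun n => hv0 n (κ n)) (fun n => (hκ n).le) ?_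
  simpa using hinf.add tendsto_one_div_add_atTop_nhds_zero_nat
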